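/- arXiv:1012.5415 — 3 statements merged into one kernel-verified Lean document; each statement's English description precedes it below -/
import Mathlib

section
/- The simple-minded output operator satisfies conjoining output (AND): for any normative system G, any proposition a, and any propositions x and y, if x ∈ Out(G, a) and y ∈ Out(G, a), then x ∩ y ∈ Out(G, a). -/
/-- Simple-minded output: `x ∈ Out(G, a)` iff there are finitely many (at least one)
norms `(a_i, x_i)` in `G` with `a ⊆ a_i` for each `i` and `⋂ x_i ⊆ x`. -/
def Out {V : Type*} (G : Set (Set V × Set V)) (a x : Set V) : Prop :=
  ∃ (n : ℕ) (p : Fin (n + 1) → Set V × Set V),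
    (∀ i, p i ∈ G) ∧ (∀ i, a ⊆ (p i).1) ∧ (⋂ i, (p i).2) ⊆ x

/-- Conjoining output (AND). -/
theorem out_conjoining_output {V : Type*} (G : Set (Set V × Set V))
    (a x y : Set V) (hx : Out G a x) (hy : Out G a y) : Out G a (x ∩ y) := by
  obtain ⟨n, p, hpG, hpa, hpx⟩ := hx
  obtain ⟨m, q, hqG, hqa, hqy⟩ := hy
  have append_forall (P : Set V × Set V → Prop) (hp : ∀ i, P (p i)) (hq : ∀ j, P (q j)) :
      ∀ k, P (Fin.append p q k) :=
    Fin.addCases (fun i => by simpa only [Fin.append_left] using hp i)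
      (fun j => by simpa only [Fin.append_right] using hq j)
  refine ⟨n + 1 + m, (Fin.append p q :), append_forall (· ∈ G) hpG hqG,
    append_forall (a ⊆ ·.1) hpa hqa, fun v hv => ⟨hpx ?_, hqy ?_⟩⟩
  · refine Set.mem_iInter.2 fun i => ?_
    simpa only [Fin.append_left] using Set.mem_iInter.1 hv (Fin.castAdd (m + 1) i)
  · refine Set.mem_iInter.2 fun j => ?_
    simpa only [Fin.append_right] using Set.mem_iInter.1 hv (Fin.natAdd (n + 1) j)
end

section
/- For every natural number n, the Boolean lattice of all subsets of an n-element set can be partitioned into exactly C(n, ⌊n/2⌋) chains; that is, there exists a partition of the powerset of Fin n into pairwise disjoint nonempty subfamilies, each totally ordered by inclusion, whose number of parts equals the binomial coefficient n choose ⌊n/2⌋. -/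
/-- The Boolean lattice of subsets of `s` admits a symmetric chain decomposition, given here by a
labelling `f` whose fibres are the chains: the ranks met by the chain through `x` include
everything between `#x` and `#s - #x`. -/
theorem Finset.exists_symmetric_chain_labelling {α : Type*} [DecidableEq α] (s : Finset α) :
    ∃ f : Finset α → List Prop,
      (∀ x ⊆ s, ∀ y ⊆ s, f x = f y → x ⊆ y ∨ y ⊆ x) ∧
      ∀ x ⊆ s, ∀ j, min x.card (s.card - x.card) ≤ j → j ≤ max x.card (s.card - x.card) →
        ∃ y ⊆ s, f y = f x ∧ y.card = j := by
  induction s using Finset.induction_on with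
  | empty =>
    refine ⟨fun _ ↦ [], fun x hx y _ _ ↦ ?_, fun x hx j _ hj ↦ ⟨x, hx, rfl, ?_⟩⟩
    · simp [Finset.subset_empty.mp hx]
    · obtain rfl := Finset.subset_empty.mp hx
      simpa [eq_comm] using hj
  | insert a s ha ih =>
    obtain ⟨f, hchain, hrank⟩ := ih
    let top : Finset α → Prop := fun x ↦ ∀ y ⊆ s, f y = f x → y.card ≤ x.card
    have erase_sub {x : Finset α} (hx : x ⊆ insert a s) : x.erase a ⊆ s :=
      Finset.subset_insert_iff.mp hx
    have subset_top {x y : Finset α} (hx : x ⊆ s) (hy : y ⊆ s) (h : f y = f x) (ht : top x) :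
        y ⊆ x := by
      rcases hchain x hx y hy h.symm with hxy | hyx
      · exact (Finset.eq_of_subset_of_card_le hxy (ht y hy h)).ge
      · exact hyx
    refine ⟨fun x ↦ (a ∈ x ∧ ¬ top (x.erase a)) :: f (x.erase a), ?_, ?_⟩
    · intro x hx y hy h
      simp only [List.cons.injEq, eq_iff_iff] at h
      obtain ⟨hlabel, h⟩ := h
      have key {u v : Finset α} (huv : u.erase a ⊆ v.erase a) (hmem : a ∈ u → a ∈ v) :
          u ⊆ v := by
        intro b hb
        by_cases hba : b = a
        · exact hba ▸ hmem (hba ▸ hb)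
        · exact Finset.mem_of_mem_erase (huv (Finset.mem_erase.mpr ⟨hba, hb⟩))
      by_cases hax : a ∈ x <;> by_cases hay : a ∈ y
      · exact (hchain _ (erase_sub hx) _ (erase_sub hy) h).imp
          (fun h ↦ key h fun _ ↦ hay) (fun h ↦ key h fun _ ↦ hax)
      · have ht : top (x.erase a) := by tauto
        exact .inr (key (subset_top (erase_sub hx) (erase_sub hy) h.symm ht) fun _ ↦ hax)
      · have ht : top (y.erase a) := by tauto
        exact .inl (key (subset_top (erase_sub hy) (erase_sub hx) h ht) fun _ ↦ hay)
      · exact (hchain _ (erase_sub hx) _ (erase_sub hy) h).imp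
          (fun h ↦ key h fun h ↦ absurd h hax) (fun h ↦ key h fun h ↦ absurd h hay)
    · intro x hx j hj₁ hj₂
      have hxs := erase_sub hx
      set z := x.erase a with hz
      obtain ⟨t, ht, htmax⟩ := Finset.exists_max_image
        {y ∈ s.powerset | f y = f z} Finset.card ⟨z, by simp [hxs]⟩
      simp only [Finset.mem_filter, Finset.mem_powerset, and_imp] at ht htmax
      obtain ⟨hts, hft⟩ := ht
      have httop : top t := fun y hy h ↦ htmax y hy (h.trans hft)
      have hcard {y : Finset α} (hy : y ⊆ s) (h : f y = f z) : s.card - y.card ≤ t.card := by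
        obtain ⟨w, hw, hfw, hwc⟩ := hrank y hy (s.card - y.card) (min_le_right _ _)
          (le_max_right _ _)
        exact hwc ▸ htmax w hw (hfw.trans h)
      have hfill (i : ℕ) (h₁ : s.card - t.card ≤ i) (h₂ : i ≤ t.card) :
          ∃ y ⊆ s, f y = f z ∧ y.card = i := by
        obtain ⟨y, hy, hfy, hyc⟩ := hrank t hts i (by omega) (by omega)
        exact ⟨y, hy, hfy.trans hft, hyc⟩
      have hzt := htmax z hxs rfl
      have hzt' := hcard hxs rfl
      have hts' := Finset.card_le_card hts
      have hzs' := Finset.card_le_card hxs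
      rw [Finset.card_insert_of_notMem ha] at hj₁ hj₂
      have hxc : x.card = z.card + if a ∈ x then 1 else 0 := by
        split_ifs with hax
        · exact (Finset.card_erase_add_one hax).symm
        · rw [hz, Finset.erase_eq_of_notMem hax, add_zero]
      by_cases hlabel : a ∈ x ∧ ¬ top z
      · have hlt : z.card < t.card := by
          by_contra! hle
          exact hlabel.2 fun y hy h ↦ (htmax y hy h).trans hle
        rw [if_pos hlabel.1] at hxc
        obtain ⟨y, hy, hfy, hyc⟩ := hfill (j - 1) (by omega) (by omega)
        have hay : a ∉ y := fun h ↦ ha (hy h)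
        have hytop : ¬ top y := fun h ↦ by
          have := h t hts (hft.trans hfy.symm)
          omega
        refine ⟨insert a y, Finset.insert_subset_insert a hy, ?_, ?_⟩
        · simp [Finset.erase_insert hay, hfy, hytop, hlabel, ← hz]
        · rw [Finset.card_insert_of_notMem hay]
          omega
      · have hxt : x.card ≤ t.card + 1 := by split_ifs at hxc <;> omega
        rcases Nat.lt_or_ge t.card j with hj | hj
        · have hat : a ∉ t := fun h ↦ ha (hts h)
          refine ⟨insert a t, Finset.insert_subset_insert a hts, ?_, ?_⟩
          · simp only [Finset.erase_insert hat, hft, ← hz, hlabel, httop, not_true, and_false]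
          · rw [Finset.card_insert_of_notMem hat]
            split_ifs at hxc <;> omega
        · obtain ⟨y, hy, hfy, hyc⟩ := hfill j (by split_ifs at hxc <;> omega) hj
          have hay : a ∉ y := fun h ↦ ha (hy h)
          refine ⟨y, hy.trans (Finset.subset_insert a s), ?_, hyc⟩
          simp only [Finset.erase_eq_of_notMem hay, hfy, ← hz, hlabel, hay, false_and]

/-- The Boolean lattice of all subsets of an `n`-element set can be partitioned
into exactly `C(n, ⌊n/2⌋)` chains (Hansel chains / symmetric chain decomposition). -/
theorem powerset_partition_into_chains (n : ℕ) :
    ∃ P : Finset (Finset (Finset (Fin n))),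
      (∀ c ∈ P, c.Nonempty) ∧
      (∀ c ∈ P, ∀ x ∈ c, ∀ y ∈ c, x ⊆ y ∨ y ⊆ x) ∧
      (∀ c ∈ P, ∀ d ∈ P, c ≠ d → Disjoint c d) ∧
      (∀ x : Finset (Fin n), ∃ c ∈ P, x ∈ c) ∧
      P.card = n.choose (n / 2) := by
  classical
  obtain ⟨f, hchain, hrank⟩ :=
    Finset.exists_symmetric_chain_labelling (Finset.univ : Finset (Fin n))
  simp only [Finset.subset_univ, forall_const, true_and, Finset.card_univ,
    Fintype.card_fin] at hchain hrank
  let fibre : Finset (Fin n) → Finset (Finset (Fin n)) := fun x ↦ {y | f y = f x}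
  have mem_fibre {x y : Finset (Fin n)} : y ∈ fibre x ↔ f y = f x := by simp [fibre]
  refine ⟨(Finset.powersetCard (n / 2) Finset.univ).image fibre, ?_, ?_, ?_, ?_, ?_⟩
  · simp only [Finset.forall_mem_image]
    exact fun x _ ↦ ⟨x, mem_fibre.mpr rfl⟩
  · simp only [Finset.forall_mem_image, mem_fibre]
    exact fun _ _ x hx y hy ↦ hchain x y (hx.trans hy.symm)
  · simp only [Finset.forall_mem_image]
    intro x _ y _ hne
    refine Finset.disjoint_left.mpr fun z hzx hzy ↦ hne ?_
    have hxy : f x = f y := (mem_fibre.mp hzx).symm.trans (mem_fibre.mp hzy)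
    simp only [fibre, hxy]
  · intro x
    obtain ⟨y, hfy, hyc⟩ := hrank x (n / 2) (by omega) (by omega)
    exact ⟨fibre y, Finset.mem_image_of_mem _ (by simp [hyc]), mem_fibre.mpr hfy.symm⟩
  · rw [Finset.card_image_of_injOn, Finset.card_powersetCard, Finset.card_univ, Fintype.card_fin]
    intro x hx y hy hxy
    have hcard : x.card = y.card := by simp_all
    have hf : f x = f y := mem_fibre.mp (hxy ▸ mem_fibre.mpr rfl)
    rcases hchain x y hf with h | h
    · exact Finset.eq_of_subset_of_card_le h hcard.ge
    · exact (Finset.eq_of_subset_of_card_le h hcard.le).symm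
end

section
/- Upper bound in Hansel's theorem: for every natural number n there exists a correct adaptive query strategy (decision tree) that identifies any unknown monotone Boolean function f : (Fin n → Bool) → Bool using at most C(n, ⌊n/2⌋) + C(n, ⌊n/2⌋ + 1) queries, where each query asks for the value f(v) at a chosen vector v. -/
/-- An adaptive query strategy (decision tree): each internal node queries
the value of the unknown function at a vector, each leaf outputs a function. -/
inductive Strategy (n : ℕ) : Type where
  | leaf : ((Fin n → Bool) → Bool) → Strategy n
  | node : (Fin n → Bool) → Strategy n → Strategy n → Strategy n

/-- Run a strategy against a function `f`: follow the branch determined by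
`f`'s answers, returning the leaf label together with the number of queries used. -/
def Strategy.run {n : ℕ} : Strategy n → ((Fin n → Bool) → Bool) → ((Fin n → Bool) → Bool) × ℕ
  | .leaf g, _ => (g, 0)
  | .node v s₀ s₁, f =>
      let r := if f v then s₁.run f else s₀.run f
      (r.1, r.2 + 1)

/-- A Boolean function is monotone if larger inputs (pointwise, `false < true`)
give larger outputs. -/
def MonotoneBool {n : ℕ} (f : (Fin n → Bool) → Bool) : Prop :=
  ∀ v w : Fin n → Bool, (∀ i, w i = true → v i = true) → f w = true → f v = true

/-- A strategy is correct if on every monotone function it reaches a leaf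
labeled by that very function. -/
def Strategy.Correct {n : ℕ} (s : Strategy n) : Prop :=
  ∀ f : (Fin n → Bool) → Bool, MonotoneBool f → (s.run f).1 = f

/-- The number of `true` coordinates of a Boolean vector. -/
def weight {n : ℕ} (v : Fin n → Bool) : ℕ := ∑ i, (v i).toNat

theorem weight_cons {n : ℕ} (b : Bool) (v : Fin n → Bool) :
    weight (Fin.cons b v : Fin (n + 1) → Bool) = b.toNat + weight v := by
  simp [weight, Fin.sum_univ_succ]

theorem card_weight_eq_le (n k : ℕ) :
    (Finset.univ.filter fun v : Fin n → Bool => weight v = k).card ≤ n.choose k := by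
  have h : (Finset.powersetCard k (Finset.univ : Finset (Fin n))).card = n.choose k := by simp
  rw [← h]
  refine Finset.card_le_card_of_injOn (fun v => Finset.univ.filter fun i => v i = true) ?_ ?_
  · intro v hv
    have hv : weight v = k := by simpa using hv
    simp only [Finset.mem_coe, Finset.mem_powersetCard, Finset.subset_univ, true_and]
    rw [← hv, weight, Finset.card_filter]
    exact Finset.sum_congr rfl fun i _ => by cases v i <;> rfl
  · intro v _ w _ h
    funext i
    have := congrArg (i ∈ ·) h
    simpa only [Finset.mem_filter, Finset.mem_univ, true_and, eq_iff_iff, ← Bool.eq_iff_iff]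
      using this

theorem monotoneBool_iff {n : ℕ} {f : (Fin n → Bool) → Bool} : MonotoneBool f ↔ Monotone f := by
  constructor
  · intro h w v hwv hw
    exact h v w (fun i => hwv i) hw
  · intro h v w hwv hw
    exact h (show w ≤ v from hwv) hw

/-- A partition of the cube into saturated chains symmetric about the middle rank: the chain `i`
has exactly one element `elem i r` of each weight `r` with `lo i ≤ r ≤ n - lo i`. Between two
elements of a chain whose weights differ by two lies an element of a chain shorter by two. -/
structure HanselChains (n : ℕ) where
  ι : Type
  lo : ι → ℕ
  elem : ι → ℕ → Fin n → Bool
  two_mul_lo_le : ∀ i, 2 * lo i ≤ n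
  weight_elem : ∀ i r, lo i ≤ r → r + lo i ≤ n → weight (elem i r) = r
  elem_inj : ∀ i j r, lo i ≤ r → r + lo i ≤ n → lo j ≤ r → r + lo j ≤ n →
    elem i r = elem j r → i = j
  exists_elem_eq : ∀ v, ∃ i, lo i ≤ weight v ∧ weight v + lo i ≤ n ∧ elem i (weight v) = v
  elem_le_succ : ∀ i r, lo i ≤ r → r + 1 + lo i ≤ n → elem i r ≤ elem i (r + 1)
  exists_between : ∀ i r, lo i ≤ r → r + 2 + lo i ≤ n →
    ∃ j, lo j = lo i + 1 ∧ elem i r ≤ elem j (r + 1) ∧ elem j (r + 1) ≤ elem i (r + 2)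

namespace HanselChains

/-- The one-point cube is a single chain. -/
def zero : HanselChains 0 where
  ι := Unit
  lo _ := 0
  elem _ _ := Fin.elim0
  two_mul_lo_le _ := le_rfl
  weight_elem _ r _ h := by simp [weight]; omega
  elem_inj _ _ _ _ _ _ _ _ := rfl
  exists_elem_eq v := ⟨(), by simp, by simp [weight], Subsingleton.elim _ _⟩
  elem_le_succ _ r _ h := by omega
  exists_between _ r _ h := by omega

/-- A chain `c₀ < ⋯ < cₘ` yields the chains `0c₀ < ⋯ < 0cₘ < 1cₘ` and `1c₀ < ⋯ < 1cₘ₋₁` one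
dimension up, the latter being omitted if it is empty. -/
def succ {n : ℕ} (H : HanselChains n) : HanselChains (n + 1) where
  ι := H.ι ⊕ {i // 2 * H.lo i < n}
  lo := Sum.elim H.lo fun i => H.lo i + 1
  elem := Sum.elim
    (fun i r => if r + H.lo i ≤ n then Fin.cons false (H.elem i r)
      else Fin.cons true (H.elem i (r - 1)))
    (fun i r => Fin.cons true (H.elem i.1 (r - 1)))
  two_mul_lo_le := by
    rintro (i | ⟨i, hi⟩)
    · have := H.two_mul_lo_le i
      simp; omega
    · simp; omega
  weight_elem := by
    rintro (i | ⟨i, hi⟩) r h₁ h₂ <;> simp only [Sum.elim_inl, Sum.elim_inr] at h₁ h₂ ⊢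
    · have := H.two_mul_lo_le i
      split_ifs with h
      · simp [weight_cons, H.weight_elem i r h₁ h]
      · rw [weight_cons, H.weight_elem i (r - 1) (by omega) (by omega), Bool.toNat_true]
        omega
    · rw [weight_cons, H.weight_elem i (r - 1) (by omega) (by omega), Bool.toNat_true]
      omega
  elem_inj := by
    rintro (i | ⟨i, hi⟩) (j | ⟨j, hj⟩) r h₁ h₂ h₃ h₄ h <;>
      simp only [Sum.elim_inl, Sum.elim_inr] at h₁ h₂ h₃ h₄ h
    · have := H.two_mul_lo_le i
      have := H.two_mul_lo_le j
      congr 1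
      split_ifs at h with hi hj hj <;>
        simp only [Fin.cons_inj, Bool.true_eq_false, Bool.false_eq_true, false_and, true_and] at h
      · exact H.elem_inj i j r h₁ hi h₃ hj h
      · exact H.elem_inj i j (r - 1) (by omega) (by omega) (by omega) (by omega) h
    · exfalso
      have := H.two_mul_lo_le i
      split_ifs at h with hi <;>
        simp only [Fin.cons_inj, Bool.false_eq_true, false_and, true_and] at h
      have := H.elem_inj i j (r - 1) (by omega) (by omega) (by omega) (by omega) h
      subst this
      omega
    · exfalso
      have := H.two_mul_lo_le j
      split_ifs at h with hj <;>
        simp only [Fin.cons_inj, Bool.true_eq_false, false_and, true_and] at h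
      have := H.elem_inj i j (r - 1) (by omega) (by omega) (by omega) (by omega) h
      subst this
      omega
    · simp only [Fin.cons_inj, true_and] at h
      have := H.elem_inj i j (r - 1) (by omega) (by omega) (by omega) (by omega) h
      subst this
      rfl
  exists_elem_eq v := by
    obtain ⟨b, v, rfl⟩ : ∃ b w, v = Fin.cons b w := ⟨_, _, (Fin.cons_self_tail v).symm⟩
    obtain ⟨i, h₁, h₂, h₃⟩ := H.exists_elem_eq v
    rw [weight_cons]
    cases b
    · exact ⟨.inl i, by simpa using h₁, by simp; omega, by simp [h₂, h₃]⟩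
    · by_cases h : weight v + H.lo i = n
      · refine ⟨.inl i, by simp; omega, by simp; omega, ?_⟩
        have : ¬ 1 + weight v + H.lo i ≤ n := by omega
        simp [this, h₃]
      · exact ⟨.inr ⟨i, by omega⟩, by simp; omega, by simp; omega, by simp [h₃]⟩
  elem_le_succ := by
    rintro (i | ⟨i, hi⟩) r h₁ h₂ <;> simp only [Sum.elim_inl, Sum.elim_inr] at h₁ h₂ ⊢
    · rw [if_pos (by omega)]
      split_ifs with h
      · exact Fin.cons_le_cons.2 ⟨le_rfl, H.elem_le_succ i r h₁ h⟩
      · exact Fin.cons_le_cons.2 ⟨Bool.false_le _, le_rfl⟩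
    · obtain ⟨r, rfl⟩ := Nat.exists_eq_add_of_le' (show 1 ≤ r by omega)
      exact Fin.cons_le_cons.2 ⟨le_rfl, H.elem_le_succ i r (by omega) (by omega)⟩
  exists_between := by
    rintro (i | ⟨i, hi⟩) r h₁ h₂ <;> simp only [Sum.elim_inl, Sum.elim_inr] at h₁ h₂ ⊢
    · rw [if_pos (by omega)]
      split_ifs with h
      · obtain ⟨j, hj, h₃, h₄⟩ := H.exists_between i r h₁ h
        refine ⟨.inl j, hj, ?_⟩
        simp only [Sum.elim_inl]
        rw [if_pos (by omega)]
        exact ⟨Fin.cons_le_cons.2 ⟨le_rfl, h₃⟩, Fin.cons_le_cons.2 ⟨le_rfl, h₄⟩⟩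
      · exact ⟨.inr ⟨i, by omega⟩, rfl, Fin.cons_le_cons.2 ⟨Bool.false_le _, le_rfl⟩,
          Fin.cons_le_cons.2 ⟨le_rfl, H.elem_le_succ i r h₁ (by omega)⟩⟩
    · obtain ⟨r, rfl⟩ := Nat.exists_eq_add_of_le' (show 1 ≤ r by omega)
      obtain ⟨j, hj, h₃, h₄⟩ := H.exists_between i r (by omega) (by omega)
      exact ⟨.inr ⟨j, by omega⟩, by simpa using hj,
        Fin.cons_le_cons.2 ⟨le_rfl, h₃⟩, Fin.cons_le_cons.2 ⟨le_rfl, h₄⟩⟩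

theorem elem_mono {n : ℕ} (H : HanselChains n) (i : H.ι) {r s : ℕ} (hr : H.lo i ≤ r) (hrs : r ≤ s)
    (hs : s + H.lo i ≤ n) : H.elem i r ≤ H.elem i s := by
  induction s, hrs using Nat.le_induction with
  | base => exact le_rfl
  | succ s hrs ih => exact (ih (by omega)).trans (H.elem_le_succ i s (by omega) hs)

end HanselChains

theorem nonempty_hanselChains (n : ℕ) : Nonempty (HanselChains n) := by
  induction n with
  | zero => exact ⟨.zero⟩
  | succ n ih => exact ih.map .succ

/-- The value of a monotone function `f` at `v` does not follow from its values on `D`. -/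
def Undetermined {α : Type*} [LE α] (f : α → Bool) (D : Set α) (v : α) : Prop :=
  ∀ w ∈ D, (w ≤ v → f w = false) ∧ (v ≤ w → f w = true)

open Classical in
/-- Settling the vectors in order of decreasing level, and asking only for values that do not
follow from those at higher levels. -/
theorem exists_strategy_of_level {n : ℕ} (level : (Fin n → Bool) → ℕ)
    (R : Finset (Fin n → Bool)) (g : (Fin n → Bool) → Bool) :
    ∃ s : Strategy n, ∀ f, Monotone f → (∀ v ∉ R, f v = g v) → (s.run f).1 = f ∧
      (s.run f).2 ≤ (R.filter fun v => Undetermined f {w | level v < level w} v).card := by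
  induction R using Finset.induction_on_max_value level generalizing g with
  | empty => exact ⟨.leaf g, fun f _ h => ⟨(funext fun v => h v (by simp)).symm, Nat.zero_le _⟩⟩
  | insert a R ha hmax ih =>
    have hupdate {f : (Fin n → Bool) → Bool} {b : Bool} (hf : ∀ v ∉ insert a R, f v = g v)
        (hb : f a = b) : ∀ v ∉ R, f v = Function.update g a b v := by
      intro v hv
      rcases eq_or_ne v a with rfl | hva
      · simpa using hb
      · rw [Function.update_of_ne hva]
        exact hf v (by simp [hva, hv])
    by_cases hU : Undetermined g {w | w ∉ insert a R} a
    · choose t ht using fun b => ih (Function.update g a b)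
      refine ⟨.node a (t false) (t true), fun f hmono hf => ?_⟩
      have hUf : Undetermined f {w | level a < level w} a := by
        intro w hw
        have hw' : w ∉ insert a R := by
          rintro hwR
          rcases Finset.mem_insert.1 hwR with rfl | hwR
          · exact lt_irrefl (level w) hw
          · exact (hmax w hwR).not_gt hw
        rw [hf w hw']
        exact hU w hw'
      rw [Finset.filter_insert, if_pos hUf, Finset.card_insert_of_notMem (by simp [ha])]
      have key := ht (f a) f hmono (hupdate hf rfl)
      cases hfa : f a <;> rw [hfa] at key <;> simpa [Strategy.run, hfa] using key
    · obtain ⟨b, hb⟩ : ∃ b, ∀ f, Monotone f → (∀ v ∉ insert a R, f v = g v) → f a = b := by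
        simp only [Undetermined, not_forall] at hU
        obtain ⟨w, hw, hU⟩ := hU
        cases hgw : g w
        · refine ⟨false, fun f hmono hf => ?_⟩
          have haw : a ≤ w := by_contra fun h => hU ⟨fun _ => hgw, fun h' => absurd h' h⟩
          have := hmono haw
          rw [hf w hw, hgw] at this
          exact le_bot_iff.1 this
        · refine ⟨true, fun f hmono hf => ?_⟩
          have hwa : w ≤ a := by_contra fun h => hU ⟨fun h' => absurd h' h, fun _ => hgw⟩
          have := hmono hwa
          rw [hf w hw, hgw] at this
          exact top_le_iff.1 this
      obtain ⟨t, ht⟩ := ih (Function.update g a b)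
      refine ⟨t, fun f hmono hf => ?_⟩
      obtain ⟨h₁, h₂⟩ := ht f hmono (hupdate hf (hb f hmono hf))
      exact ⟨h₁, h₂.trans (Finset.card_le_card (Finset.filter_subset_filter _ (by simp)))⟩

open Classical in
/-- At most two vectors of each chain are undetermined by the shorter chains, and at most one if
the chain is a singleton; they inject into the two middle ranks. -/
theorem exists_level_card_undetermined_le (n : ℕ) :
    ∃ level : (Fin n → Bool) → ℕ, ∀ f : (Fin n → Bool) → Bool,
      (Finset.univ.filter fun v => Undetermined f {w | level v < level w} v).card ≤
        n.choose (n / 2) + n.choose (n / 2 + 1) := by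
  obtain ⟨H⟩ := nonempty_hanselChains n
  choose idx h₁ h₂ h₃ using H.exists_elem_eq
  have idx_elem (j r) (hr : H.lo j ≤ r) (hr' : r + H.lo j ≤ n) : idx (H.elem j r) = j := by
    have hw := H.weight_elem j r hr hr'
    have a := h₁ (H.elem j r)
    have b := h₂ (H.elem j r)
    have c := h₃ (H.elem j r)
    rw [hw] at a b c
    exact H.elem_inj _ _ r a b hr hr' c
  refine ⟨fun v => H.lo (idx v), fun f => ?_⟩
  have weight_le {u v : Fin n → Bool} (hi : idx u = idx v)
      (hu : Undetermined f {w | H.lo (idx u) < H.lo (idx w)} u)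
      (hv : Undetermined f {w | H.lo (idx v) < H.lo (idx w)} v) : weight v ≤ weight u + 1 := by
    by_contra! hlt
    have hu₁ := h₁ u
    have hv₂ := h₂ v
    rw [← hi] at hv₂
    obtain ⟨j, hj, hl, hr⟩ := H.exists_between (idx u) (weight u) hu₁ (by omega)
    have hmem : H.lo (idx u) < H.lo (idx (H.elem j (weight u + 1))) := by
      rw [idx_elem j _ (by omega) (by omega)]
      omega
    have hf := (hv _ (show H.lo (idx v) < _ from hi ▸ hmem)).1 <| hr.trans <| by
      conv_rhs => rw [← h₃ v, ← hi]
      exact H.elem_mono _ (by omega) hlt hv₂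
    have ht := (hu _ hmem).2 (by rwa [h₃ u] at hl)
    simp [hf] at ht
  let mid (v : Fin n → Bool) : ℕ := if weight v % 2 = n / 2 % 2 then n / 2 else n / 2 + 1
  have mid_mem (v) : H.lo (idx v) ≤ mid v ∧ mid v + H.lo (idx v) ≤ n := by
    have := h₁ v
    have := h₂ v
    simp only [mid]
    split_ifs <;> omega
  have weight_mid (v) : weight (H.elem (idx v) (mid v)) = mid v :=
    H.weight_elem _ _ (mid_mem v).1 (mid_mem v).2
  calc _ ≤ (Finset.univ.filter fun v : Fin n → Bool =>
          weight v = n / 2 ∨ weight v = n / 2 + 1).card := by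
        refine Finset.card_le_card_of_injOn (fun v => H.elem (idx v) (mid v)) ?_ ?_
        · intro v _
          simp only [Finset.coe_filter, Finset.mem_univ, true_and, Set.mem_ofPred_eq, weight_mid,
            mid]
          split_ifs <;> simp
        · intro u hu v hv huv
          simp only [Finset.coe_filter, Finset.mem_univ, true_and, Set.mem_ofPred_eq] at hu hv huv
          have hi : idx u = idx v := by
            rw [← idx_elem _ _ (mid_mem u).1 (mid_mem u).2, huv,
              idx_elem _ _ (mid_mem v).1 (mid_mem v).2]
          have hm : mid u = mid v := by rw [← weight_mid u, huv, weight_mid]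
          have huv' := weight_le hi hu hv
          have hvu' := weight_le hi.symm hv hu
          have hw : weight u = weight v := by
            simp only [mid] at hm
            split_ifs at hm <;> omega
          rw [← h₃ u, ← h₃ v, hi, hw]
    _ ≤ _ := by
        rw [Finset.filter_or]
        exact (Finset.card_union_le _ _).trans
          (add_le_add (card_weight_eq_le _ _) (card_weight_eq_le _ _))

/-- Upper bound in Hansel's theorem: some correct strategy identifies every
monotone Boolean function using at most `C(n, ⌊n/2⌋) + C(n, ⌊n/2⌋ + 1)` queries. -/
theorem hansel_upper_bound (n : ℕ) :
    ∃ s : Strategy n, s.Correct ∧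
      ∀ f : (Fin n → Bool) → Bool, MonotoneBool f →
        (s.run f).2 ≤ n.choose (n / 2) + n.choose (n / 2 + 1) := by
  obtain ⟨level, hlevel⟩ := exists_level_card_undetermined_le n
  obtain ⟨s, hs⟩ := exists_strategy_of_level level Finset.univ fun _ => false
  have hs' (f) (hf : MonotoneBool f) := hs f (monotoneBool_iff.1 hf) (by simp)
  exact ⟨s, fun f hf => (hs' f hf).1, fun f hf => (hs' f hf).2.trans (hlevel f)⟩
end
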